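/- Let C be a self-dual [54,27,10] binary code with fewer than 27 codewords of weight 10, and let S be its shadow. Then S contains no vector of weight 3, the number of vectors of weight 7 in S lies in {41,42,43}, and the number of codewords of C of weight 10 lies in {7,15,23}. -/

import Mathlib

/-- The (Hamming) weight of a vector over `ZMod 2`. -/
def wt {ι : Type*} [Fintype ι] (x : ι → ZMod 2) : ℕ :=
  (Finset.univ.filter fun i => x i ≠ 0).card

/-- The dual code of a binary linear code. -/
def dualCode {ι : Type*} [Fintype ι] (C : Submodule (ZMod 2) (ι → ZMod 2)) :
    Submodule (ZMod 2) (ι → ZMod 2) where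
  carrier := {x | ∀ c ∈ C, ∑ i, x i * c i = 0}
  zero_mem' := by intro c _; simp
  add_mem' := by
    intro a b ha hb c hc
    simp only [Set.mem_setOf_eq] at ha hb ⊢
    simp [Pi.add_apply, add_mul, Finset.sum_add_distrib, ha c hc, hb c hc]
  smul_mem' := by
    intro r a ha c hc
    simp only [Set.mem_setOf_eq] at ha ⊢
    simp [Pi.smul_apply, smul_eq_mul, mul_assoc, ← Finset.mul_sum, ha c hc]

/-- A binary linear code is self-dual if it equals its dual. -/
def IsSelfDual {ι : Type*} [Fintype ι] (C : Submodule (ZMod 2) (ι → ZMod 2)) : Prop :=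
  C = dualCode C

/-- A binary code is even if every codeword has even weight. -/
def IsEvenCode {ι : Type*} [Fintype ι] (C : Submodule (ZMod 2) (ι → ZMod 2)) : Prop :=
  ∀ c ∈ C, 2 ∣ wt c

/-- `C` has minimum weight `d`: some nonzero codeword has weight `d` and
no nonzero codeword has smaller weight. -/
def HasMinWt {ι : Type*} [Fintype ι] (C : Submodule (ZMod 2) (ι → ZMod 2)) (d : ℕ) : Prop :=
  (∃ c ∈ C, c ≠ 0 ∧ wt c = d) ∧ ∀ c ∈ C, c ≠ 0 → d ≤ wt c

/-- `Awt C i` is the number `A_i(C)` of codewords of `C` of weight `i`. -/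
noncomputable def Awt {ι : Type*} [Fintype ι]
    (C : Submodule (ZMod 2) (ι → ZMod 2)) (i : ℕ) : ℕ :=
  Set.ncard {c ∈ (C : Set (ι → ZMod 2)) | wt c = i}

/-- `C` performs better than `C'`: the weight distribution of `C` is
lexicographically smaller than that of `C'`. -/
def LexSmaller {ι : Type*} [Fintype ι]
    (C C' : Submodule (ZMod 2) (ι → ZMod 2)) : Prop :=
  ∃ s : ℕ, (∀ i < s, Awt C i = Awt C' i) ∧ Awt C s < Awt C' s

/-- A circulant matrix: each row is the cyclic shift (by one position) of the previous one,
equivalently the matrix is invariant under simultaneously cyclically shifting rows and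
columns. -/
def IsCirculant {n : ℕ} (R : Matrix (Fin n) (Fin n) (ZMod 2)) : Prop :=
  ∀ i j k : Fin n, R (i + k) (j + k) = R i j

/-- The generator matrix `(I_n | R)`. -/
def genMat {n : ℕ} (R : Matrix (Fin n) (Fin n) (ZMod 2)) :
    Matrix (Fin n) (Fin n ⊕ Fin n) (ZMod 2) :=
  Matrix.of fun i => Sum.elim (fun j => if i = j then (1 : ZMod 2) else 0) (R i)

/-- The row space (span of the rows) of a matrix over `ZMod 2`. -/
def rowSpan {ι κ : Type*} (M : Matrix ι κ (ZMod 2)) : Submodule (ZMod 2) (κ → ZMod 2) :=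
  Submodule.span (ZMod 2) (Set.range M)

/-- The bordered matrix `B` with `B 0 0 = α`, the rest of the first row and first
column all ones, and remaining block the matrix `R'`. -/
def borderMat {m : ℕ} (α : ZMod 2) (R' : Matrix (Fin m) (Fin m) (ZMod 2)) :
    Matrix (Fin (m + 1)) (Fin (m + 1)) (ZMod 2) :=
  Matrix.of fun i j =>
    if hi : i = 0 then (if j = 0 then α else 1)
    else if hj : j = 0 then 1
    else R' (i.pred hi) (j.pred hj)

/-- `C` is a pure double circulant code of length `2n`. -/
def IsPureDC {n : ℕ} (C : Submodule (ZMod 2) (Fin n ⊕ Fin n → ZMod 2)) : Prop :=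
  ∃ R : Matrix (Fin n) (Fin n) (ZMod 2), IsCirculant R ∧ C = rowSpan (genMat R)

/-- `C` is a bordered double circulant code of length `2(m+1)`. -/
def IsBorderedDC {m : ℕ} (C : Submodule (ZMod 2) (Fin (m + 1) ⊕ Fin (m + 1) → ZMod 2)) : Prop :=
  ∃ (α : ZMod 2) (R' : Matrix (Fin m) (Fin m) (ZMod 2)),
    IsCirculant R' ∧ C = rowSpan (genMat (borderMat α R'))

/-- `C` is a double circulant code: pure or bordered. -/
def IsDC {m : ℕ} (C : Submodule (ZMod 2) (Fin (m + 1) ⊕ Fin (m + 1) → ZMod 2)) : Prop :=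
  IsPureDC C ∨ IsBorderedDC C

/-- The dual of a set of vectors. -/
def dualSet {ι : Type*} [Fintype ι] (X : Set (ι → ZMod 2)) : Set (ι → ZMod 2) :=
  {x | ∀ c ∈ X, ∑ i, x i * c i = 0}

/-- The shadow `S = C_0^⊥ \ C` of `C`, where `C_0` is the doubly even subcode. -/
def shadowSet {ι : Type*} [Fintype ι] (C : Submodule (ZMod 2) (ι → ZMod 2)) :
    Set (ι → ZMod 2) :=
  dualSet {c ∈ (C : Set (ι → ZMod 2)) | 4 ∣ wt c} \ (C : Set (ι → ZMod 2))

section Parity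

variable {ι : Type*} [Fintype ι]

lemma wt_eq_sum (x : ι → ZMod 2) : wt x = ∑ i, if x i ≠ 0 then 1 else 0 := by
  simp [wt, Finset.card_filter]

lemma wt_eq_zero_iff (x : ι → ZMod 2) : wt x = 0 ↔ x = 0 := by
  simp [wt, Finset.filter_eq_empty_iff, funext_iff]

/-- The size of the intersection of the supports of two binary vectors. -/
def interCard (x y : ι → ZMod 2) : ℕ :=
  ∑ i, if x i ≠ 0 ∧ y i ≠ 0 then 1 else 0

lemma wt_add (x y : ι → ZMod 2) : wt (x + y) + 2 * interCard x y = wt x + wt y := by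
  have h : ∀ a b : ZMod 2, (if a + b ≠ 0 then 1 else 0) + 2 * (if a ≠ 0 ∧ b ≠ 0 then 1 else 0) =
      (if a ≠ 0 then 1 else 0) + (if b ≠ 0 then 1 else 0) := by decide
  simp only [wt_eq_sum, interCard, Finset.mul_sum, ← Finset.sum_add_distrib]
  exact Finset.sum_congr rfl fun i _ => h (x i) (y i)

lemma cast_interCard (x y : ι → ZMod 2) : (interCard x y : ZMod 2) = ∑ i, x i * y i := by
  simp only [interCard, Nat.cast_sum]
  refine Finset.sum_congr rfl fun i _ => ?_
  generalize x i = a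
  generalize y i = b
  revert a b
  decide

lemma cast_wt (x : ι → ZMod 2) : (wt x : ZMod 2) = ∑ i, x i * x i := by
  rw [← cast_interCard]
  simp [interCard, wt_eq_sum]

lemma wt_one_add (x : ι → ZMod 2) : wt (1 + x) + wt x = Fintype.card ι := by
  rw [wt_eq_sum, wt_eq_sum, ← Finset.sum_add_distrib, Fintype.card_eq_sum_ones]
  have h : ∀ a : ZMod 2, (if 1 + a ≠ 0 then 1 else 0) + (if a ≠ 0 then 1 else 0) = 1 := by decide
  exact Finset.sum_congr rfl fun i _ => h (x i)

end Parity

section SignedMacWilliams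

open Polynomial

variable {ι : Type*} [Fintype ι]

/-- The nontrivial character of `ZMod 2`, with values in `ℤ`. -/
def sgn (a : ZMod 2) : ℤ := if a = 0 then 1 else -1

lemma sgn_add (a b : ZMod 2) : sgn (a + b) = sgn a * sgn b := by
  revert a b; decide

lemma sgn_sum {κ : Type*} (s : Finset κ) (f : κ → ZMod 2) :
    sgn (∑ i ∈ s, f i) = ∏ i ∈ s, sgn (f i) := by
  classical
  induction s using Finset.induction_on with
  | empty => simp [sgn]
  | insert a s ha ih => rw [Finset.sum_insert ha, Finset.prod_insert ha, sgn_add, ih]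

/-- The value at `i` of the Krawtchouk polynomial of degree `j` for length `n`. -/
def krawtchouk (n j i : ℕ) : ℤ :=
  ∑ k ∈ Finset.range (j + 1), (-1) ^ k * (i.choose k : ℤ) * ((n - i).choose (j - k) : ℤ)

lemma coeff_one_sub_X_pow_mul (n j i : ℕ) :
    (((1 - X) ^ i * (1 + X) ^ (n - i) : ℤ[X])).coeff j = krawtchouk n j i := by
  have h (k : ℕ) : ((1 - X : ℤ[X]) ^ i).coeff k = (-1) ^ k * (i.choose k : ℤ) := by
    have : (1 - X : ℤ[X]) ^ i = ((1 + X : ℤ[X]) ^ i).comp (C (-1) * X) := by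
      simp [sub_eq_add_neg]
    rw [this, comp_C_mul_X_coeff, coeff_one_add_X_pow, mul_comm]
  simp [krawtchouk, coeff_mul, h, coeff_one_add_X_pow,
    Finset.Nat.sum_antidiagonal_eq_sum_range_succ_mk]

lemma sum_sgn_mul_X_pow_wt [DecidableEq ι] (c : ι → ZMod 2) :
    ∑ x : ι → ZMod 2, (C (sgn (∑ i, x i * c i)) * X ^ wt x : ℤ[X]) =
      (1 - X) ^ wt c * (1 + X) ^ (Fintype.card ι - wt c) := by
  have h1 (x : ι → ZMod 2) : (C (sgn (∑ i, x i * c i)) * X ^ wt x : ℤ[X]) =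
      ∏ i, (C (sgn (x i * c i)) * X ^ (if x i ≠ 0 then 1 else 0)) := by
    rw [sgn_sum, wt_eq_sum, map_prod, Finset.prod_mul_distrib, Finset.prod_pow_eq_pow_sum]
  have h2 (b : ZMod 2) : ∑ a : ZMod 2, (C (sgn (a * b)) * X ^ (if a ≠ 0 then 1 else 0) : ℤ[X]) =
      if b ≠ 0 then 1 - X else 1 + X := by
    have hb : b = 0 ∨ b = 1 := by revert b; decide
    have hu : (Finset.univ : Finset (ZMod 2)) = {0, 1} := by decide
    rcases hb with rfl | rfl <;> simp [hu, sgn, sub_eq_add_neg]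
  have h3 : (Finset.univ.filter fun i => ¬ c i ≠ 0).card = Fintype.card ι - wt c := by
    have := Finset.card_filter_add_card_filter_not (s := Finset.univ) (fun i => c i ≠ 0)
    rw [Finset.card_univ] at this
    rw [wt]
    omega
  have h4 := Finset.prod_univ_sum (fun _ : ι => (Finset.univ : Finset (ZMod 2)))
    (fun i a => (C (sgn (a * c i)) * X ^ (if a ≠ 0 then 1 else 0) : ℤ[X]))
  rw [Fintype.piFinset_univ] at h4
  simp only [h1, ← h4, h2]
  rw [Finset.prod_ite, Finset.prod_const, Finset.prod_const, h3, wt]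

lemma sum_sgn_wt_eq [DecidableEq ι] (c : ι → ZMod 2) (j : ℕ) :
    ∑ x : ι → ZMod 2, (if wt x = j then sgn (∑ i, x i * c i) else 0) =
      krawtchouk (Fintype.card ι) j (wt c) := by
  rw [← coeff_one_sub_X_pow_mul, ← sum_sgn_mul_X_pow_wt, finsetSum_coeff]
  simp [coeff_X_pow, eq_comm]

open Classical in
lemma sum_sgn_submodule [DecidableEq ι] (C : Submodule (ZMod 2) (ι → ZMod 2)) (e : (ι → ZMod 2) → ZMod 2)
    (he : ∀ c ∈ C, ∀ d ∈ C, e (c + d) = e c + e d) :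
    ∑ c with c ∈ C, sgn (e c) = if ∀ c ∈ C, e c = 0 then (Nat.card C : ℤ) else 0 := by
  split_ifs with h
  · rw [Finset.sum_congr rfl (g := fun _ => (1 : ℤ))
      (fun c hc => by simp [sgn, h c (Finset.mem_filter.1 hc).2])]
    simp [Nat.card_eq_fintype_card, Fintype.card_subtype]
  · push Not at h
    obtain ⟨d, hd, hed⟩ := h
    have hs : sgn (e d) = -1 := by simp [sgn, hed]
    have : ∑ c with c ∈ C, sgn (e c) = ∑ c with c ∈ C, sgn (e (c + d)) := by
      refine Finset.sum_nbij' (fun c => c - d) (fun c => c + d) ?_ ?_ ?_ ?_ ?_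
      · simpa using fun c hc => C.sub_mem hc hd
      · simpa using fun c hc => C.add_mem hc hd
      · simp
      · simp
      · simp
    have hneg : ∑ c with c ∈ C, sgn (e (c + d)) = -∑ c with c ∈ C, sgn (e c) := by
      rw [← Finset.sum_neg_distrib]
      refine Finset.sum_congr rfl fun c hc => ?_
      rw [he c (Finset.mem_filter.1 hc).2 d hd, sgn_add, hs, mul_neg_one]
    linarith

open Classical in
/-- MacWilliams identity twisted by the character `sgn ∘ e` of `C`. -/
lemma sum_sgn_mul_krawtchouk [DecidableEq ι] (C : Submodule (ZMod 2) (ι → ZMod 2)) (e : (ι → ZMod 2) → ZMod 2)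
    (he : ∀ c ∈ C, ∀ d ∈ C, e (c + d) = e c + e d) (j : ℕ) :
    ∑ c with c ∈ C, sgn (e c) * krawtchouk (Fintype.card ι) j (wt c) =
      Nat.card C * Set.ncard {x | (∀ c ∈ C, ∑ i, x i * c i = e c) ∧ wt x = j} := by
  have hx (x : ι → ZMod 2) : ∑ c with c ∈ C, sgn (e c + ∑ i, x i * c i) =
      if ∀ c ∈ C, ∑ i, x i * c i = e c then (Nat.card C : ℤ) else 0 := by
    rw [sum_sgn_submodule C fun c => e c + ∑ i, x i * c i]
    · simp only [CharTwo.add_eq_zero]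
      simp only [eq_comm]
    · intro c hc d hd
      simp only [he c hc d hd, Pi.add_apply, mul_add, Finset.sum_add_distrib]
      ring
  calc
    _ = ∑ x : ι → ZMod 2, if wt x = j then
          ∑ c with c ∈ C, sgn (e c + ∑ i, x i * c i) else 0 := by
      simp only [← sum_sgn_wt_eq, Finset.mul_sum]
      rw [Finset.sum_comm]
      refine Finset.sum_congr rfl fun x _ => ?_
      split_ifs <;> simp [sgn_add]
    _ = _ := by
      simp only [hx, ← ite_and]
      rw [← Finset.sum_filter, Finset.sum_const, Set.ncard_eq_toFinset_card', nsmul_eq_mul, mul_comm]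
      congr 3
      ext x
      simp [and_comm]

end SignedMacWilliams

section SelfDual

variable {ι : Type*} [Fintype ι] {C : Submodule (ZMod 2) (ι → ZMod 2)}

lemma IsSelfDual.mem_iff (h : IsSelfDual C) (x : ι → ZMod 2) :
    x ∈ C ↔ ∀ c ∈ C, ∑ i, x i * c i = 0 := by
  conv_lhs => rw [h]
  rfl

lemma IsSelfDual.isEvenCode (h : IsSelfDual C) : IsEvenCode C := fun c hc => by
  rw [← ZMod.natCast_eq_zero_iff, cast_wt]
  exact (h.mem_iff c).1 hc c hc

lemma IsSelfDual.one_mem (h : IsSelfDual C) : 1 ∈ C := by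
  rw [h.mem_iff]
  intro c hc
  have hsq : ∀ a : ZMod 2, a * a = a := by decide
  simpa [hsq] using (h.mem_iff c).1 hc c hc

lemma IsSelfDual.cast_half_wt_add (h : IsSelfDual C) {c d : ι → ZMod 2} (hc : c ∈ C)
    (hd : d ∈ C) : ((wt (c + d) / 2 : ℕ) : ZMod 2) = (wt c / 2 : ℕ) + (wt d / 2 : ℕ) := by
  have h1 := h.isEvenCode c hc
  have h2 := h.isEvenCode d hd
  have h3 := wt_add c d
  have h4 : (interCard c d : ZMod 2) = 0 := by
    rw [cast_interCard]
    exact (h.mem_iff c).1 hc d hd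
  have h5 : wt c / 2 + wt d / 2 = wt (c + d) / 2 + interCard c d := by omega
  rw [← Nat.cast_add, h5, Nat.cast_add, h4, add_zero]

lemma cast_half_eq_zero_iff {w : ℕ} (hw : 2 ∣ w) : ((w / 2 : ℕ) : ZMod 2) = 0 ↔ 4 ∣ w := by
  rw [ZMod.natCast_eq_zero_iff]
  omega

/-- The shadow of a singly even self-dual code consists of the vectors inducing the character
`c ↦ (-1) ^ (wt c / 2)`. -/
lemma IsSelfDual.mem_shadowSet_iff (h : IsSelfDual C) (hC : ∃ c ∈ C, ¬ 4 ∣ wt c)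
    (x : ι → ZMod 2) :
    x ∈ shadowSet C ↔ ∀ c ∈ C, ∑ i, x i * c i = ((wt c / 2 : ℕ) : ZMod 2) := by
  have hne : ∀ a : ZMod 2, a ≠ 0 ↔ a = 1 := by decide
  have key {c : ι → ZMod 2} (hc : c ∈ C) := cast_half_eq_zero_iff (h.isEvenCode c hc)
  simp only [shadowSet, Set.mem_sdiff, SetLike.mem_coe, h.mem_iff x, dualSet, Set.mem_ofPred_eq]
  constructor
  · rintro ⟨h0, h1⟩ c hc
    push Not at h1
    obtain ⟨d, hd, hxd⟩ := h1
    have hd4 : ¬ 4 ∣ wt d := fun h4 => hxd (h0 d ⟨hd, h4⟩)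
    by_cases hc4 : 4 ∣ wt c
    · rw [h0 c ⟨hc, hc4⟩, (key hc).2 hc4]
    · rw [← key hc, ← ne_eq, hne] at hc4
      rw [← key hd, ← ne_eq, hne] at hd4
      have hcd : 4 ∣ wt (c + d) := by
        rw [← key (C.add_mem hc hd), h.cast_half_wt_add hc hd, hc4, hd4]
        decide
      have := h0 (c + d) ⟨C.add_mem hc hd, hcd⟩
      simp only [Pi.add_apply, mul_add, Finset.sum_add_distrib] at this
      rw [CharTwo.add_eq_zero] at this
      rw [this, hc4, ← hne]
      exact hxd
  · refine fun hx => ⟨fun c hc => (hx c hc.1).trans ((key hc.1).2 hc.2), fun h0 => ?_⟩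
    obtain ⟨c, hc, hc4⟩ := hC
    exact hc4 ((key hc).1 ((hx c hc).symm.trans (h0 c hc)))

lemma IsSelfDual.add_mem_of_mem_shadowSet (h : IsSelfDual C) (hC : ∃ c ∈ C, ¬ 4 ∣ wt c)
    {x y : ι → ZMod 2} (hx : x ∈ shadowSet C) (hy : y ∈ shadowSet C) : x + y ∈ C := by
  rw [h.mem_shadowSet_iff hC] at hx hy
  rw [h.mem_iff]
  intro c hc
  simp only [Pi.add_apply, add_mul, Finset.sum_add_distrib, hx c hc, hy c hc]
  exact CharTwo.add_self_eq_zero _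

end SelfDual

section Enumerator

variable {ι : Type*} [Fintype ι] {C : Submodule (ZMod 2) (ι → ZMod 2)}

open Classical in
lemma sum_filter_mem_congr [DecidableEq ι] {f g : (ι → ZMod 2) → ℤ} (h : ∀ c ∈ C, f c = g c) :
    ∑ c with c ∈ C, f c = ∑ c with c ∈ C, g c :=
  Finset.sum_congr rfl fun c hc => h c (Finset.mem_filter.1 hc).2

open Classical in
lemma sum_ite_wt_eq [DecidableEq ι] (C : Submodule (ZMod 2) (ι → ZMod 2)) (j : ℕ) :
    ∑ c with c ∈ C, (if wt c = j then 1 else 0 : ℤ) = Awt C j := by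
  rw [Finset.sum_boole, Awt, Set.ncard_eq_toFinset_card', Finset.filter_filter]
  congr 2
  ext x
  simp

lemma Awt_zero (C : Submodule (ZMod 2) (ι → ZMod 2)) : Awt C 0 = 1 := by
  rw [Awt, Set.ncard_eq_one]
  refine ⟨0, ?_⟩
  ext x
  simp only [wt_eq_zero_iff, Set.mem_ofPred_eq, Set.mem_singleton_iff, SetLike.mem_coe]
  exact ⟨fun h => h.2, by rintro rfl; exact ⟨C.zero_mem, rfl⟩⟩

lemma Awt_eq_of_add_eq_card (hC : 1 ∈ C) {i j : ℕ} (hij : i + j = Fintype.card ι) :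
    Awt C i = Awt C j := by
  have h2 (x : ι → ZMod 2) : 1 + (1 + x) = x := by
    have h : ∀ a : ZMod 2, 1 + (1 + a) = a := by decide
    exact funext fun i => h (x i)
  refine Set.ncard_congr (fun x _ => 1 + x) ?_ ?_ ?_
  · rintro x ⟨hx, rfl⟩
    have := wt_one_add x
    exact ⟨C.add_mem hC hx, by omega⟩
  · intro x y _ _ hxy
    simpa using hxy
  · rintro y ⟨hy, rfl⟩
    have := wt_one_add y
    exact ⟨1 + y, ⟨C.add_mem hC hy, by omega⟩, h2 y⟩

lemma HasMinWt.Awt_eq_zero {d i : ℕ} (h : HasMinWt C d) (hi : 0 < i) (hid : i < d) :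
    Awt C i = 0 := by
  rw [Awt, Set.ncard_eq_zero]
  ext x
  simp only [Set.mem_ofPred_eq, SetLike.mem_coe, Set.mem_empty_iff_false, iff_false]
  rintro ⟨hx, rfl⟩
  refine hid.not_ge (h.2 x hx fun h0 => ?_)
  rw [(wt_eq_zero_iff x).2 h0] at hi
  exact hi.false

open Classical in
lemma IsSelfDual.sum_krawtchouk [DecidableEq ι] (h : IsSelfDual C) (j : ℕ) :
    ∑ c with c ∈ C, krawtchouk (Fintype.card ι) j (wt c) = Nat.card C * Awt C j := by
  have := sum_sgn_mul_krawtchouk C (fun _ => 0) (by simp) j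
  simp only [← h.mem_iff] at this
  simpa [sgn, Awt] using this

open Classical in
lemma IsSelfDual.sum_sgn_half_krawtchouk [DecidableEq ι] (h : IsSelfDual C)
    (hC : ∃ c ∈ C, ¬ 4 ∣ wt c) (j : ℕ) :
    ∑ c with c ∈ C, sgn (wt c / 2 : ℕ) * krawtchouk (Fintype.card ι) j (wt c) =
      Nat.card C * Set.ncard {x ∈ shadowSet C | wt x = j} := by
  convert sum_sgn_mul_krawtchouk C (fun c => (wt c / 2 : ℕ))
    (fun c hc d hd => h.cast_half_wt_add hc hd) j using 4
  simp only [h.mem_shadowSet_iff hC]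

end Enumerator

/-- A combination of Krawtchouk values, for length 54, vanishing at all the weights other than
0, 10, 44 and 54 that an even self-complementary code of minimum weight 10 can have. -/
def testFun (i : ℕ) : ℤ :=
  351 * krawtchouk 54 0 i + 91 * krawtchouk 54 2 i + 47 * krawtchouk 54 4 i
    + 3 * krawtchouk 54 6 i + 3 * krawtchouk 54 8 i - krawtchouk 54 10 i
    - 192 * (sgn (i / 2 : ℕ) * krawtchouk 54 3 i) - 16 * (sgn (i / 2 : ℕ) * krawtchouk 54 7 i)

lemma testFun_eq {i : ℕ} (hi : 2 ∣ i) (h10 : i = 0 ∨ 10 ≤ i) (h44 : i ≤ 44 ∨ i = 54) :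
    testFun i = 2 ^ 26 * ((if i = 10 then 1 else 0) + (if i = 44 then 1 else 0)
      - 351 * (if i = 0 then 1 else 0) - 351 * (if i = 54 then 1 else 0)) := by
  suffices h : ∀ i < 55, 2 ∣ i → (i = 0 ∨ 10 ≤ i) → (i ≤ 44 ∨ i = 54) → testFun i =
      2 ^ 26 * ((if i = 10 then 1 else 0) + (if i = 44 then 1 else 0)
        - 351 * (if i = 0 then 1 else 0) - 351 * (if i = 54 then 1 else 0)) from
    h i (by omega) hi h10 h44
  simp only [testFun, sgn, ZMod.natCast_eq_zero_iff, krawtchouk,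
    Nat.choose_eq_descFactorial_div_factorial]
  decide +kernel

theorem weight_ten_relation (C : Submodule (ZMod 2) (Fin 54 → ZMod 2))
    (hsd : IsSelfDual C) (hdim : Module.finrank (ZMod 2) C = 27) (hmin : HasMinWt C 10) :
    Awt C 10 + 8 * Set.ncard {s ∈ shadowSet C | wt s = 7}
      + 96 * Set.ncard {s ∈ shadowSet C | wt s = 3} = 351 := by
  classical
  have hC : ∃ c ∈ C, ¬ 4 ∣ wt c := by
    obtain ⟨c, hc, -, hw⟩ := hmin.1
    exact ⟨c, hc, by rw [hw]; decide⟩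
  have hcard : (Nat.card C : ℤ) = 2 ^ 27 := by
    rw [Module.natCard_eq_pow_finrank (K := ZMod 2), hdim]
    simp
  have hwt (c : Fin 54 → ZMod 2) (hc : c ∈ C) : wt c = 0 ∨ 10 ≤ wt c := by
    rw [wt_eq_zero_iff]
    exact or_iff_not_imp_left.2 (hmin.2 c hc)
  have hM (j : ℕ) := hsd.sum_krawtchouk j
  have hS (j : ℕ) := hsd.sum_sgn_half_krawtchouk hC j
  simp only [Fintype.card_fin, hcard] at hM hS
  have hsum : ∑ c with c ∈ C, testFun (wt c) = 2 ^ 26 * (Awt C 10 + Awt C 44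
      - 351 * Awt C 0 - 351 * Awt C 54) := by
    have h44 (c : Fin 54 → ZMod 2) (hc : c ∈ C) : wt c ≤ 44 ∨ wt c = 54 := by
      have h1 := hwt _ (C.add_mem hsd.one_mem hc)
      have h2 := wt_one_add c
      rw [Fintype.card_fin] at h2
      omega
    rw [sum_filter_mem_congr fun c hc =>
      testFun_eq (hsd.isEvenCode c hc) (hwt c hc) (h44 c hc)]
    simp only [← Finset.mul_sum, Finset.sum_add_distrib, Finset.sum_sub_distrib, sum_ite_wt_eq]
  have hsum' : ∑ c with c ∈ C, testFun (wt c) = 2 ^ 27 * (351 * Awt C 0 + 91 * Awt C 2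
      + 47 * Awt C 4 + 3 * Awt C 6 + 3 * Awt C 8 - Awt C 10
      - 192 * Set.ncard {s ∈ shadowSet C | wt s = 3}
      - 16 * Set.ncard {s ∈ shadowSet C | wt s = 7}) := by
    simp only [testFun, Finset.sum_add_distrib, Finset.sum_sub_distrib, ← Finset.mul_sum, hM, hS]
    ring
  have h44 : Awt C 44 = Awt C 10 := Awt_eq_of_add_eq_card hsd.one_mem (by simp)
  have h54 : Awt C 54 = Awt C 0 := Awt_eq_of_add_eq_card hsd.one_mem (by simp)
  rw [hsum', h44, h54, Awt_zero, hmin.Awt_eq_zero (i := 2), hmin.Awt_eq_zero (i := 4),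
    hmin.Awt_eq_zero (i := 6), hmin.Awt_eq_zero (i := 8)] at hsum <;> omega

/-- A self-dual `[54, 27, 10]` code with fewer than 27 codewords of weight 10
has no weight-3 vector in its shadow, the number of weight-7 shadow vectors lies in
`{41, 42, 43}`, and `A_10` lies in `{7, 15, 23}`. -/
theorem stmt_3 (C : Submodule (ZMod 2) (Fin 54 → ZMod 2))
    (hsd : IsSelfDual C) (hdim : Module.finrank (ZMod 2) C = 27)
    (hmin : HasMinWt C 10) (hA : Awt C 10 < 27) :
    (∀ s ∈ shadowSet C, wt s ≠ 3) ∧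
    Set.ncard {s ∈ shadowSet C | wt s = 7} ∈ ({41, 42, 43} : Set ℕ) ∧
    Awt C 10 ∈ ({7, 15, 23} : Set ℕ) := by
  have hrel := weight_ten_relation C hsd hdim hmin
  have hC : ∃ c ∈ C, ¬ 4 ∣ wt c := by
    obtain ⟨c, hc, -, hw⟩ := hmin.1
    exact ⟨c, hc, by rw [hw]; decide⟩
  have hpos : 0 < Awt C 10 := by
    obtain ⟨c, hc, -, hw⟩ := hmin.1
    exact (Set.ncard_pos (Set.toFinite _)).2 ⟨c, hc, hw⟩
  have hadd {s t : Fin 54 → ZMod 2} (hs : s ∈ shadowSet C) (ht : t ∈ shadowSet C) (hne : s ≠ t) :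
      10 ≤ wt (s + t) :=
    hmin.2 _ (hsd.add_mem_of_mem_shadowSet hC hs ht) (by rwa [Ne, CharTwo.add_eq_zero])
  have h3 : Set.ncard {s ∈ shadowSet C | wt s = 3} ≤ 1 := by
    rw [Set.ncard_le_one (Set.toFinite _)]
    rintro s ⟨hs, hs3⟩ t ⟨ht, ht3⟩
    by_contra hne
    have := hadd hs ht hne
    have := wt_add s t
    omega
  have hno : ∀ s ∈ shadowSet C, wt s ≠ 3 := by
    intro s hs hs3
    have h7 : Set.ncard {s ∈ shadowSet C | wt s = 7} ≤ Awt C 10 := by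
      refine Set.ncard_le_ncard_of_injOn (fun t => s + t) ?_
        (fun x _ y _ hxy => add_left_cancel hxy) (Set.toFinite _)
      rintro t ⟨ht, ht7⟩
      have := hadd hs ht (by rintro rfl; omega)
      have := wt_add s t
      exact ⟨hsd.add_mem_of_mem_shadowSet hC hs ht, by omega⟩
    omega
  have h0 : Set.ncard {s ∈ shadowSet C | wt s = 3} = 0 := by
    rw [Set.ncard_eq_zero]
    ext s
    simpa using hno s
  refine ⟨hno, ?_, ?_⟩ <;> simp only [Set.mem_insert_iff, Set.mem_singleton_iff] <;> omega
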